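/- (Preprocessing perturbation of ν.) Let ρ ≥ 1, r > 0, σ_ν > 0. Let ν be a distribution with weights ν_1,…,ν_m on points y_1,…,y_m ∈ ℝ^d with ‖y_i − y_j‖₂ ≤ r for all i, j. Set L_ν = {j : ν_j < σ_ν/m} and ζ_ν = Σ_{j∈L_ν} ν_j, and assume ζ_ν < 1. Let ν′ be the distribution on the same points with weights ν′_j = 0 for j ∈ L_ν and ν′_j = ν_j/(1 − ζ_ν) otherwise. Then R_ρ(ν, ν′)^ρ ≤ ζ_ν·r^ρ ≤ σ_ν·r^ρ; in particular R_ρ(ν, ν′) ≤ σ_ν^{1/ρ}·r. -/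

import Mathlib

open Finset

noncomputable section

/-- A coupling of two discrete distributions given by weight vectors. -/
def IsCoupling {n m : ℕ} (μ : Fin n → ℝ) (ν : Fin m → ℝ) (γ : Fin n → Fin m → ℝ) : Prop :=
  (∀ i j, 0 ≤ γ i j) ∧ (∀ i, ∑ j, γ i j = μ i) ∧ (∀ j, ∑ i, γ i j = ν j)

/-- The ℓ_ρ-transport cost of a coupling γ. (Terms with `μ i * ν j = 0` contribute 0 by
Lean's conventions `x / 0 = 0`, `0 ^ ρ = 0` for `ρ ≠ 0`.) -/
def transportCost {d n m : ℕ} (x : Fin n → EuclideanSpace ℝ (Fin d))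
    (y : Fin m → EuclideanSpace ℝ (Fin d)) (μ : Fin n → ℝ) (ν : Fin m → ℝ) (ρ : ℝ)
    (γ : Fin n → Fin m → ℝ) : ℝ :=
  (∑ i, ∑ j, μ i * ν j * ((γ i j / (μ i * ν j)) * ‖x i - y j‖) ^ ρ) ^ (1 / ρ)

/-- The ℓ_ρ-optimal-transport cost `R_ρ(μ, ν)`. -/
def Rrho {d n m : ℕ} (x : Fin n → EuclideanSpace ℝ (Fin d))
    (y : Fin m → EuclideanSpace ℝ (Fin d)) (μ : Fin n → ℝ) (ν : Fin m → ℝ) (ρ : ℝ) : ℝ :=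
  sInf {c | ∃ γ, IsCoupling μ ν γ ∧ c = transportCost x y μ ν ρ γ}

/-- `ζ_ν`: the total mass of indices whose weight is below the threshold `θ`. -/
def lowMass {n : ℕ} (ν : Fin n → ℝ) (θ : ℝ) : ℝ :=
  ∑ i ∈ Finset.univ.filter (fun i => ν i < θ), ν i

/-- `ν′`: weights with low-probability indices removed, renormalized. -/
def truncWeights {n : ℕ} (ν : Fin n → ℝ) (θ : ℝ) : Fin n → ℝ :=
  fun i => if ν i < θ then 0 else ν i / (1 - lowMass ν θ)

theorem transportCost_nonneg {d n m : ℕ} {x : Fin n → EuclideanSpace ℝ (Fin d)}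
    {y : Fin m → EuclideanSpace ℝ (Fin d)} {μ : Fin n → ℝ} {ν : Fin m → ℝ} (ρ : ℝ)
    {γ : Fin n → Fin m → ℝ} (h : IsCoupling μ ν γ) : 0 ≤ transportCost x y μ ν ρ γ := by
  obtain ⟨hγ, hμ, hν⟩ := h
  have hμ0 : ∀ i, 0 ≤ μ i := fun i => hμ i ▸ sum_nonneg fun j _ => hγ i j
  have hν0 : ∀ j, 0 ≤ ν j := fun j => hν j ▸ sum_nonneg fun i _ => hγ i j
  refine Real.rpow_nonneg (sum_nonneg fun i _ => sum_nonneg fun j _ => ?_) _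
  have := hμ0 i
  have := hν0 j
  have := hγ i j
  positivity

theorem Rrho_nonneg {d n m : ℕ} (x : Fin n → EuclideanSpace ℝ (Fin d))
    (y : Fin m → EuclideanSpace ℝ (Fin d)) (μ : Fin n → ℝ) (ν : Fin m → ℝ) (ρ : ℝ) :
    0 ≤ Rrho x y μ ν ρ := by
  refine Real.sInf_nonneg ?_
  rintro _ ⟨γ, hγ, rfl⟩
  exact transportCost_nonneg ρ hγ

theorem Rrho_le_transportCost {d n m : ℕ} (x : Fin n → EuclideanSpace ℝ (Fin d))
    (y : Fin m → EuclideanSpace ℝ (Fin d)) {μ : Fin n → ℝ} {ν : Fin m → ℝ} (ρ : ℝ)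
    {γ : Fin n → Fin m → ℝ} (h : IsCoupling μ ν γ) :
    Rrho x y μ ν ρ ≤ transportCost x y μ ν ρ γ := by
  refine csInf_le ⟨0, ?_⟩ ⟨γ, h, rfl⟩
  rintro _ ⟨γ', hγ', rfl⟩
  exact transportCost_nonneg ρ hγ'

theorem lowMass_nonneg {n : ℕ} {ν : Fin n → ℝ} (hν : ∀ i, 0 ≤ ν i) (θ : ℝ) :
    0 ≤ lowMass ν θ :=
  sum_nonneg fun i _ => hν i

theorem lowMass_eq_sum_ite {n : ℕ} (ν : Fin n → ℝ) (θ : ℝ) :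
    lowMass ν θ = ∑ i, if ν i < θ then ν i else 0 :=
  sum_filter _ _

theorem lowMass_div_card_le {n : ℕ} (ν : Fin n → ℝ) {σ : ℝ} (hσ : 0 ≤ σ) :
    lowMass ν (σ / n) ≤ σ := by
  have hσn : 0 ≤ σ / n := by positivity
  calc lowMass ν (σ / n) = ∑ i, if ν i < σ / n then ν i else 0 := lowMass_eq_sum_ite ν _
    _ ≤ ∑ _i : Fin n, σ / n := sum_le_sum fun i _ => by split_ifs <;> linarith
    _ = n * (σ / n) := by simp
    _ ≤ σ := by
      rcases eq_or_ne (n : ℝ) 0 with h | h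
      · simpa [h] using hσ
      · exact (mul_div_cancel₀ σ h).le

theorem truncWeights_nonneg {n : ℕ} {ν : Fin n → ℝ} {θ : ℝ} (hν : ∀ i, 0 ≤ ν i)
    (hζ : lowMass ν θ < 1) (i : Fin n) : 0 ≤ truncWeights ν θ i := by
  unfold truncWeights
  split_ifs
  · exact le_rfl
  · exact div_nonneg (hν i) (by linarith)

theorem sum_truncWeights {n : ℕ} {ν : Fin n → ℝ} {θ : ℝ} (hν : ∑ i, ν i = 1)
    (hζ : lowMass ν θ < 1) : ∑ i, truncWeights ν θ i = 1 := by
  have hne : 1 - lowMass ν θ ≠ 0 := by linarith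
  have h : ∀ i, truncWeights ν θ i =
      (ν i - if ν i < θ then ν i else 0) / (1 - lowMass ν θ) := by
    intro i
    unfold truncWeights
    split_ifs <;> simp
  simp_rw [h]
  rw [← sum_div, sum_sub_distrib, hν, ← lowMass_eq_sum_ite, div_self hne]

/-- The coupling of `ν` with its truncation which spreads the mass of each low-probability index
proportionally to the truncated weights and leaves all other mass in place. -/
def truncCoupling {n : ℕ} (ν : Fin n → ℝ) (θ : ℝ) (i j : Fin n) : ℝ :=
  if ν i < θ then ν i * truncWeights ν θ j else if i = j then ν i else 0

theorem isCoupling_truncCoupling {n : ℕ} {ν : Fin n → ℝ} {θ : ℝ} (hν0 : ∀ i, 0 ≤ ν i)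
    (hν1 : ∑ i, ν i = 1) (hζ : lowMass ν θ < 1) :
    IsCoupling ν (truncWeights ν θ) (truncCoupling ν θ) := by
  refine ⟨fun i j => ?_, fun i => ?_, fun j => ?_⟩
  · have := hν0 i
    have := truncWeights_nonneg hν0 hζ j
    unfold truncCoupling
    split_ifs <;> positivity
  · unfold truncCoupling
    by_cases h : ν i < θ
    · simp [h, ← mul_sum, sum_truncWeights hν1 hζ]
    · simp [h]
  · have h : ∀ i, truncCoupling ν θ i j = (if ν i < θ then ν i else 0) * truncWeights ν θ j +
        if i = j then (if ν j < θ then 0 else ν j) else 0 := by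
      intro i
      unfold truncCoupling
      by_cases hij : i = j
      · subst hij
        by_cases hi : ν i < θ <;> simp [hi]
      · by_cases hi : ν i < θ <;> simp [hi, hij]
    simp_rw [h]
    rw [sum_add_distrib, ← sum_mul, ← lowMass_eq_sum_ite, sum_ite_eq' univ j, if_pos (mem_univ j)]
    have hne : 1 - lowMass ν θ ≠ 0 := by linarith
    unfold truncWeights
    split_ifs
    · simp
    · field_simp
      ring

theorem transportCost_truncCoupling_le {d n : ℕ} (y : Fin n → EuclideanSpace ℝ (Fin d))
    {ρ r θ : ℝ} (hρ : 0 < ρ) {ν : Fin n → ℝ} (hν0 : ∀ i, 0 ≤ ν i)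
    (hν1 : ∑ i, ν i = 1) (hyr : ∀ i j, ‖y i - y j‖ ≤ r) (hζ : lowMass ν θ < 1) :
    transportCost y y ν (truncWeights ν θ) ρ (truncCoupling ν θ) ≤
      (lowMass ν θ * r ^ ρ) ^ (1 / ρ) := by
  have hterm : ∀ i j, ν i * truncWeights ν θ j *
      (truncCoupling ν θ i j / (ν i * truncWeights ν θ j) * ‖y i - y j‖) ^ ρ ≤
      (if ν i < θ then ν i else 0) * truncWeights ν θ j * r ^ ρ := by
    intro i j
    have hi0 := hν0 i
    have hj0 := truncWeights_nonneg hν0 hζ j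
    unfold truncCoupling
    by_cases hi : ν i < θ
    · simp only [hi, if_true]
      rcases eq_or_ne (ν i * truncWeights ν θ j) 0 with h0 | h0
      · simp [h0]
      · rw [div_self h0, one_mul]
        gcongr
        exact hyr i j
    · by_cases hij : i = j
      · subst hij
        simp [hi, Real.zero_rpow hρ.ne']
      · simp [hi, hij, Real.zero_rpow hρ.ne']
  have hnonneg : ∀ i j, 0 ≤ ν i * truncWeights ν θ j *
      (truncCoupling ν θ i j / (ν i * truncWeights ν θ j) * ‖y i - y j‖) ^ ρ := by
    intro i j
    have := hν0 i
    have := truncWeights_nonneg hν0 hζ j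
    have := (isCoupling_truncCoupling hν0 hν1 hζ).1 i j
    positivity
  refine Real.rpow_le_rpow (sum_nonneg fun i _ => sum_nonneg fun j _ => hnonneg i j) ?_
    (by positivity)
  refine (sum_le_sum fun i _ => sum_le_sum fun j _ => hterm i j).trans_eq ?_
  simp_rw [← sum_mul, ← mul_sum, sum_truncWeights hν1 hζ, mul_one, ← lowMass_eq_sum_ite]

/-- preprocessing perturbation of `ν` (on the same point set). -/
theorem preprocess_nu {d m : ℕ} (y : Fin m → EuclideanSpace ℝ (Fin d))
    (ρ r σν : ℝ) (hρ : 1 ≤ ρ) (hr : 0 < r) (hσν : 0 < σν)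
    (ν : Fin m → ℝ) (hν0 : ∀ j, 0 ≤ ν j) (hν1 : ∑ j, ν j = 1)
    (hyr : ∀ i j, ‖y i - y j‖ ≤ r)
    (hζ : lowMass ν (σν / m) < 1) :
    Rrho y y ν (truncWeights ν (σν / m)) ρ ^ ρ ≤ lowMass ν (σν / m) * r ^ ρ ∧
    lowMass ν (σν / m) * r ^ ρ ≤ σν * r ^ ρ ∧
    Rrho y y ν (truncWeights ν (σν / m)) ρ ≤ σν ^ (1 / ρ) * r := by
  have hρ0 : 0 < ρ := by linarith
  have hζ0 := lowMass_nonneg hν0 (σν / m)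
  have hζσ := lowMass_div_card_le ν hσν.le
  have hR := (Rrho_le_transportCost y y ρ (isCoupling_truncCoupling hν0 hν1 hζ)).trans
    (transportCost_truncCoupling_le y hρ0 hν0 hν1 hyr hζ)
  have hle : lowMass ν (σν / m) * r ^ ρ ≤ σν * r ^ ρ := by gcongr
  refine ⟨?_, hle, hR.trans ?_⟩
  · calc _ ≤ ((lowMass ν (σν / m) * r ^ ρ) ^ (1 / ρ)) ^ ρ :=
          Real.rpow_le_rpow (Rrho_nonneg _ _ _ _ _) hR hρ0.le
      _ = _ := by rw [one_div, Real.rpow_inv_rpow (by positivity) hρ0.ne']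
  · calc _ ≤ (σν * r ^ ρ) ^ (1 / ρ) := by gcongr
      _ = _ := by
        rw [Real.mul_rpow hσν.le (by positivity), one_div, Real.rpow_rpow_inv hr.le hρ0.ne']
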